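/- Let β > 0 and fix a comparability constant K ≥ 1. Then there exists a constant C > 0 such that for every n ∈ ℤ³ one has Σ ⟨n₁ + n₂⟩^{−2β} ⟨n₁⟩^{−2} ⟨n₂⟩^{−2} ⟨n₃⟩^{−2} ≤ C ⟨n⟩^{−2β}, where the sum runs over all triples (n₁, n₂, n₃) ∈ (ℤ³)³ with n₁ + n₂ + n₃ = n, n₁ + n₂ ≠ 0, and K^{−1} ‖n₃‖ ≤ ‖n₁ + n₂‖ ≤ K ‖n₃‖. -/

import Mathlib

noncomputable section

/-- Japanese bracket `⟨n⟩ = (1 + ‖n‖²)^{1/2}` of a lattice point `n ∈ ℤ³`. -/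
def jb (n : Fin 3 → ℤ) : ℝ :=
  Real.sqrt (1 + ∑ i, ((n i : ℝ)) ^ 2)

/-- Euclidean norm `‖n‖` of a lattice point `n ∈ ℤ³`. -/
def latNorm (n : Fin 3 → ℤ) : ℝ :=
  Real.sqrt (∑ i, ((n i : ℝ)) ^ 2)

theorem one_le_jb (n : Fin 3 → ℤ) : 1 ≤ jb n := by
  rw [jb, Real.one_le_sqrt]
  have : 0 ≤ ∑ i, ((n i : ℝ)) ^ 2 := Finset.sum_nonneg fun i _ => sq_nonneg _
  linarith

theorem jb_pos (n : Fin 3 → ℤ) : 0 < jb n := one_pos.trans_le (one_le_jb n)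

theorem jb_sq (n : Fin 3 → ℤ) : jb n ^ 2 = 1 + latNorm n ^ 2 := by
  have : 0 ≤ ∑ i, ((n i : ℝ)) ^ 2 := Finset.sum_nonneg fun i _ => sq_nonneg _
  rw [jb, latNorm, Real.sq_sqrt this, Real.sq_sqrt (by linarith)]

theorem latNorm_nonneg (n : Fin 3 → ℤ) : 0 ≤ latNorm n := Real.sqrt_nonneg _

theorem latNorm_eq_norm (n : Fin 3 → ℤ) :
    latNorm n = ‖WithLp.toLp 2 (fun i => (n i : ℝ))‖ := by
  simp [latNorm, EuclideanSpace.norm_eq]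

theorem latNorm_add_le (a b : Fin 3 → ℤ) : latNorm (a + b) ≤ latNorm a + latNorm b := by
  simp only [latNorm_eq_norm]
  refine le_of_eq_of_le (congrArg norm ?_) (norm_add_le _ _)
  ext i
  simp

theorem jb_add_le (a b : Fin 3 → ℤ) : jb (a + b) ≤ jb a + jb b := by
  have hab := latNorm_add_le a b
  have h1 := latNorm_nonneg (a + b)
  have ha := jb_sq a
  have hb := jb_sq b
  have hs := jb_sq (a + b)
  have ha' : latNorm a ≤ jb a :=
    abs_le_of_sq_le_sq' (by linarith) (jb_pos a).le |>.2
  have hb' : latNorm b ≤ jb b :=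
    abs_le_of_sq_le_sq' (by linarith) (jb_pos b).le |>.2
  refine abs_le_of_sq_le_sq' ?_ (add_pos (jb_pos a) (jb_pos b)).le |>.2
  have := mul_le_mul ha' hb' (latNorm_nonneg b) (jb_pos a).le
  nlinarith

theorem jb_le_mul_of_latNorm_le {K : ℝ} (hK : 1 ≤ K) {a b : Fin 3 → ℤ}
    (h : latNorm a ≤ K * latNorm b) : jb a ≤ K * jb b := by
  refine abs_le_of_sq_le_sq' ?_ (mul_pos (by linarith) (jb_pos b)).le |>.2
  have := pow_le_pow_left₀ (latNorm_nonneg a) h 2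
  have hK2 : 1 ≤ K ^ 2 := one_le_pow₀ hK
  rw [mul_pow, jb_sq, jb_sq]
  nlinarith

/-- Supremum norm of a lattice point, as a natural number. -/
def supNatAbs (n : Fin 3 → ℤ) : ℕ :=
  max (n 0).natAbs (max (n 1).natAbs (n 2).natAbs)

theorem one_add_supNatAbs_le (n : Fin 3 → ℤ) : 1 + (supNatAbs n : ℝ) ≤ 2 * jb n := by
  have hsq (i : Fin 3) : ((n i).natAbs : ℝ) ≤ jb n := by
    rw [Nat.cast_natAbs, Int.cast_abs, jb]
    refine Real.abs_le_sqrt ?_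
    have := Finset.single_le_sum (f := fun i => (n i : ℝ) ^ 2)
      (fun i _ => sq_nonneg _) (Finset.mem_univ i)
    linarith
  have : (supNatAbs n : ℝ) ≤ jb n := by
    simp only [supNatAbs, Nat.cast_max]
    exact max_le (hsq 0) (max_le (hsq 1) (hsq 2))
  linarith [one_le_jb n]

theorem encard_supNatAbs_fiber_le (k : ℕ) :
    (supNatAbs ⁻¹' {k}).encard ≤ (26 * (k + 1) ^ 2 : ℕ) := by
  have hcard (j : ℕ) : (Finset.Icc (fun _ => -(j : ℤ)) (fun _ => (j : ℤ)) :
      Finset (Fin 3 → ℤ)).card = (2 * j + 1) ^ 3 := by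
    rw [Pi.card_Icc]
    simp only [Int.card_Icc, Finset.prod_const, Finset.card_univ, Fintype.card_fin]
    congr 1
    omega
  rcases k with _ | k
  · have hsub : supNatAbs ⁻¹' {0} ⊆ ({0} : Set (Fin 3 → ℤ)) := by
      intro a ha
      simp only [supNatAbs, Set.mem_preimage, Set.mem_singleton_iff] at ha
      rw [Set.mem_singleton_iff]
      ext i
      fin_cases i <;> simp <;> omega
    refine (Set.encard_le_encard hsub).trans ?_
    rw [Set.encard_singleton]
    norm_num
  · let S (j : ℕ) : Finset (Fin 3 → ℤ) := Finset.Icc (fun _ => -(j : ℤ)) (fun _ => (j : ℤ))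
    have hmem (j : ℕ) (a : Fin 3 → ℤ) : a ∈ S j ↔ supNatAbs a ≤ j := by
      simp only [S, Finset.mem_Icc, Pi.le_def, ← forall_and, supNatAbs]
      refine ⟨fun h => ?_, fun h i => ?_⟩
      · have h0 := h 0
        have h1 := h 1
        have h2 := h 2
        omega
      · fin_cases i <;> simp <;> omega
    have hsub : supNatAbs ⁻¹' {k + 1} ⊆ ((S (k + 1) \ S k : Finset _) : Set (Fin 3 → ℤ)) := by
      intro a ha
      simp only [Set.mem_preimage, Set.mem_singleton_iff] at ha
      simp [hmem, ha]
    refine (Set.encard_le_encard hsub).trans ?_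
    rw [Set.encard_coe_eq_coe_finsetCard, Nat.cast_le, Finset.card_sdiff_of_subset]
    · rw [hcard, hcard, Nat.sub_le_iff_le_add]
      refine Nat.le.intro (k := 2 * k ^ 2 + 56 * k + 78) ?_
      ring
    · intro a
      simp only [hmem]
      omega

open scoped ENNReal in
theorem tsum_comp_supNatAbs_le (F : ℕ → ℝ≥0∞) :
    ∑' a, F (supNatAbs a) ≤ ∑' k, ((26 * (k + 1) ^ 2 : ℕ) : ℝ≥0∞) * F k := by
  rw [← ENNReal.tsum_fiberwise _ supNatAbs]
  refine ENNReal.tsum_le_tsum fun k => ?_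
  calc ∑' a : supNatAbs ⁻¹' {k}, F (supNatAbs a)
      = ∑' _ : supNatAbs ⁻¹' {k}, F k := tsum_congr fun a => by rw [a.2]
    _ = (supNatAbs ⁻¹' {k}).encard * F k := ENNReal.tsum_set_const _ _
    _ ≤ _ := by
      gcongr
      exact_mod_cast encard_supNatAbs_fiber_le k

theorem rpow_neg_one_sub_le_telescope {s x : ℝ} (hs : 0 < s) (hx : 0 < x) :
    (x + 1) ^ (-(1 + s)) ≤ s⁻¹ * (x ^ (-s) - (x + 1) ^ (-s)) := by
  have hx1 : 0 < x + 1 := by linarith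
  have hy : 0 < x / (x + 1) := by positivity
  have hlog : Real.log (x / (x + 1)) ≤ -(x + 1)⁻¹ := by
    refine (Real.log_le_sub_one_of_pos hy).trans_eq ?_
    field_simp
    ring
  have hpow : 1 + s * (x + 1)⁻¹ ≤ (x / (x + 1)) ^ (-s) := by
    rw [Real.rpow_def_of_pos hy]
    refine le_trans ?_ (Real.add_one_le_exp _)
    nlinarith
  rw [Real.div_rpow hx.le hx1.le, le_div_iff₀ (by positivity)] at hpow
  have hsplit : (x + 1) ^ (-(1 + s)) = (x + 1)⁻¹ * (x + 1) ^ (-s) := by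
    rw [neg_add, Real.rpow_add hx1, Real.rpow_neg_one]
  rw [hsplit, inv_mul_eq_div s, le_div_iff₀ hs]
  linarith

theorem sum_range_rpow_le {s R : ℝ} (hs : 0 < s) (hR : 0 < R) (n : ℕ) :
    ∑ k ∈ Finset.range n, (R + (k + 1)) ^ (-(1 + s)) ≤ s⁻¹ * R ^ (-s) := by
  suffices h : ∑ k ∈ Finset.range n, (R + (k + 1)) ^ (-(1 + s)) ≤
      s⁻¹ * (R ^ (-s) - (R + n) ^ (-s)) by
    refine h.trans ?_
    have : 0 ≤ (R + n) ^ (-s) := by positivity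
    gcongr
    linarith
  induction n with
  | zero => simp
  | succ n ih =>
    rw [Finset.sum_range_succ]
    have := rpow_neg_one_sub_le_telescope (x := R + n) hs (by positivity)
    push_cast
    rw [← add_assoc]
    linarith

/-- Uniform weighted tail bound for lattice sums in dimension three. -/
theorem exists_tsum_jb_rpow_le {s : ℝ} (hs : 0 < s) : ∃ C : ℝ, 0 < C ∧ ∀ R : ℝ, 0 < R →
    ∑' a : Fin 3 → ℤ, ENNReal.ofReal (jb a ^ (-(2 : ℝ)) * (R + jb a) ^ (-(1 + s))) ≤
      ENNReal.ofReal (C * R ^ (-s)) := by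
  refine ⟨104 * 2 ^ (1 + s) * s⁻¹, by positivity, fun R hR => ?_⟩
  let F (k : ℕ) : ℝ := 4 * 2 ^ (1 + s) * ((k + 1 : ℝ) ^ (-(2 : ℝ)) * (R + (k + 1)) ^ (-(1 + s)))
  have hF (a : Fin 3 → ℤ) :
      jb a ^ (-(2 : ℝ)) * (R + jb a) ^ (-(1 + s)) ≤ F (supNatAbs a) := by
    have ha := one_add_supNatAbs_le a
    have h1 : jb a ^ (-(2 : ℝ)) ≤ (2⁻¹ * (supNatAbs a + 1 : ℝ)) ^ (-(2 : ℝ)) :=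
      Real.rpow_le_rpow_of_nonpos (by positivity) (by linarith) (by norm_num)
    have h2 : (R + jb a) ^ (-(1 + s)) ≤ (2⁻¹ * (R + (supNatAbs a + 1))) ^ (-(1 + s)) :=
      Real.rpow_le_rpow_of_nonpos (by positivity) (by linarith) (by linarith)
    have hja := jb_pos a
    refine (mul_le_mul h1 h2 (by positivity) (by positivity)).trans_eq ?_
    rw [Real.mul_rpow (by norm_num) (by positivity), Real.mul_rpow (by norm_num) (by positivity),
      Real.inv_rpow (by norm_num), Real.inv_rpow (by norm_num), ← Real.rpow_neg (by norm_num),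
      ← Real.rpow_neg (by norm_num), neg_neg, neg_neg]
    norm_num [F]
    ring
  calc _ ≤ ∑' a, ENNReal.ofReal (F (supNatAbs a)) :=
        ENNReal.tsum_le_tsum fun a => ENNReal.ofReal_le_ofReal (hF a)
    _ ≤ ∑' k : ℕ, ((26 * (k + 1) ^ 2 : ℕ) : ENNReal) * ENNReal.ofReal (F k) :=
        tsum_comp_supNatAbs_le fun k => ENNReal.ofReal (F k)
    _ = ∑' k : ℕ, ENNReal.ofReal (104 * 2 ^ (1 + s) * (R + (k + 1)) ^ (-(1 + s))) := by
        refine tsum_congr fun k => ?_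
        rw [← ENNReal.ofReal_natCast, ← ENNReal.ofReal_mul (by positivity)]
        congr 1
        have hk : ((k : ℝ) + 1) ≠ 0 := by positivity
        simp only [F]
        rw [Real.rpow_neg (by positivity), Real.rpow_two]
        push_cast
        field_simp
        norm_num
    _ ≤ _ := by
        refine ENNReal.tsum_le_of_sum_range_le fun n => ?_
        rw [← ENNReal.ofReal_sum_of_nonneg fun k _ => by positivity, ← Finset.mul_sum]
        refine ENNReal.ofReal_le_ofReal ?_
        rw [mul_assoc _ s⁻¹]
        gcongr
        exact sum_range_rpow_le hs hR n

theorem jb_rpow_neg_two_mul_le (a b : Fin 3 → ℤ) :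
    jb a ^ (-(2 : ℝ)) * jb b ^ (-(2 : ℝ)) ≤
      9 * (jb a ^ (-(2 : ℝ)) * (jb (a + b) + jb a) ^ (-(1 + 1 : ℝ))) +
      9 * (jb b ^ (-(2 : ℝ)) * (jb (a + b) + jb b) ^ (-(1 + 1 : ℝ))) := by
  have key (x y : Fin 3 → ℤ) (h : jb x ≤ jb y) : jb x ^ (-(2 : ℝ)) * jb y ^ (-(2 : ℝ)) ≤
      9 * (jb x ^ (-(2 : ℝ)) * (jb (x + y) + jb x) ^ (-(1 + 1 : ℝ))) := by
    have hx := jb_pos x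
    have hxy := jb_pos (x + y)
    have h1 : jb y ^ (-(2 : ℝ)) ≤ (3⁻¹ * (jb (x + y) + jb x)) ^ (-(2 : ℝ)) :=
      Real.rpow_le_rpow_of_nonpos (by positivity) (by linarith [jb_add_le x y]) (by norm_num)
    refine (mul_le_mul_of_nonneg_left h1 (by positivity)).trans_eq ?_
    rw [Real.mul_rpow (by norm_num) (by positivity), Real.inv_rpow (by norm_num),
      ← Real.rpow_neg (by norm_num), neg_neg]
    norm_num
    ring
  have ha := jb_pos a
  have hb := jb_pos b
  have hab := jb_pos (a + b)
  rcases le_total (jb a) (jb b) with h | h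
  · exact (key a b h).trans (le_add_of_nonneg_right (by positivity))
  · rw [mul_comm (jb a ^ (-(2 : ℝ))), add_comm a b]
    exact (key b a h).trans (le_add_of_nonneg_left (by rw [add_comm b a]; positivity))

theorem exists_tsum_convolution_le : ∃ C : ℝ, 0 < C ∧ ∀ m : Fin 3 → ℤ,
    ∑' a : Fin 3 → ℤ, ENNReal.ofReal (jb a ^ (-(2 : ℝ)) * jb (m - a) ^ (-(2 : ℝ))) ≤
      ENNReal.ofReal (C * jb m ^ (-(1 : ℝ))) := by
  obtain ⟨C, hC, h⟩ := exists_tsum_jb_rpow_le one_pos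
  refine ⟨18 * C, by positivity, fun m => ?_⟩
  have hm := jb_pos m
  let G (a : Fin 3 → ℤ) : ENNReal :=
    ENNReal.ofReal (jb a ^ (-(2 : ℝ)) * (jb m + jb a) ^ (-(1 + 1 : ℝ)))
  have hG : ∑' a, G (m - a) = ∑' a, G a := (Equiv.subLeft m).tsum_eq G
  calc _ ≤ ∑' a, (ENNReal.ofReal 9 * G a + ENNReal.ofReal 9 * G (m - a)) := by
        refine ENNReal.tsum_le_tsum fun a => ?_
        have ha := jb_pos a
        have hb := jb_pos (m - a)
        simp only [G]
        rw [← ENNReal.ofReal_mul (by norm_num), ← ENNReal.ofReal_mul (by norm_num),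
          ← ENNReal.ofReal_add (by positivity) (by positivity)]
        refine ENNReal.ofReal_le_ofReal ?_
        simpa only [add_sub_cancel] using jb_rpow_neg_two_mul_le a (m - a)
    _ = ENNReal.ofReal 18 * ∑' a, G a := by
        rw [ENNReal.tsum_add, ENNReal.tsum_mul_left, ENNReal.tsum_mul_left, hG, ← add_mul,
          ← ENNReal.ofReal_add (by norm_num) (by norm_num)]
        norm_num
    _ ≤ ENNReal.ofReal 18 * ENNReal.ofReal (C * jb m ^ (-(1 : ℝ))) := by
        gcongr
        exact h _ hm
    _ = _ := by
        rw [← ENNReal.ofReal_mul (by norm_num), mul_assoc]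

theorem resonant_term_le {β K : ℝ} (hβ : 0 < β) (hK : 1 ≤ K) {m c : Fin 3 → ℤ}
    (h1 : K⁻¹ * latNorm c ≤ latNorm m) (h2 : latNorm m ≤ K * latNorm c) :
    jb m ^ (-(2 * β)) * jb c ^ (-(2 : ℝ)) ≤
      K ^ 2 * (2 + K) ^ (1 + 2 * β) *
        (jb m ^ (-(1 : ℝ)) * (jb (m + c) + jb m) ^ (-(1 + 2 * β))) := by
  have hK0 : 0 < K := by linarith
  have hm := jb_pos m
  have hc := jb_pos c
  have hn := jb_pos (m + c)
  have hmc := jb_le_mul_of_latNorm_le hK h2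
  have hcm := jb_le_mul_of_latNorm_le hK ((inv_mul_le_iff₀ hK0).1 h1)
  have hadd := jb_add_le m c
  have e1 : jb c ^ (-(2 : ℝ)) ≤ K ^ 2 * jb m ^ (-(2 : ℝ)) := by
    refine (Real.rpow_le_rpow_of_nonpos (x := K⁻¹ * jb m) (by positivity)
      ((inv_mul_le_iff₀ hK0).2 hmc) (by norm_num)).trans_eq ?_
    rw [Real.mul_rpow (by positivity) hm.le, Real.inv_rpow hK0.le, ← Real.rpow_neg hK0.le,
      neg_neg, Real.rpow_two]
  have e2 : jb m ^ (-(1 + 2 * β)) ≤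
      (2 + K) ^ (1 + 2 * β) * (jb (m + c) + jb m) ^ (-(1 + 2 * β)) := by
    refine (Real.rpow_le_rpow_of_nonpos (x := (2 + K)⁻¹ * (jb (m + c) + jb m)) (by positivity)
      ((inv_mul_le_iff₀ (by positivity)).2 (by linarith)) (by linarith)).trans_eq ?_
    rw [Real.mul_rpow (by positivity) (by positivity), Real.inv_rpow (by positivity),
      ← Real.rpow_neg (by positivity), neg_neg]
  calc jb m ^ (-(2 * β)) * jb c ^ (-(2 : ℝ))
      ≤ jb m ^ (-(2 * β)) * (K ^ 2 * jb m ^ (-(2 : ℝ))) := by gcongr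
    _ = K ^ 2 * (jb m ^ (-(1 : ℝ)) * jb m ^ (-(1 + 2 * β))) := by
        rw [mul_left_comm, ← Real.rpow_add hm, ← Real.rpow_add hm]
        ring_nf
    _ ≤ K ^ 2 * (jb m ^ (-(1 : ℝ)) *
          ((2 + K) ^ (1 + 2 * β) * (jb (m + c) + jb m) ^ (-(1 + 2 * β)))) := by gcongr
    _ = _ := by ring

theorem exists_hasSum_le_of_tsum_ofReal_le {ι : Type*} {f : ι → ℝ} (hf : 0 ≤ f) {B : ℝ}
    (hB : 0 ≤ B) (h : ∑' i, ENNReal.ofReal (f i) ≤ ENNReal.ofReal B) :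
    ∃ L, HasSum f L ∧ L ≤ B := by
  have hsum (u : Finset ι) : ∑ i ∈ u, f i ≤ B := by
    rw [← ENNReal.ofReal_le_ofReal_iff hB, ENNReal.ofReal_sum_of_nonneg fun i _ => hf i]
    exact (ENNReal.sum_le_tsum u).trans h
  exact ⟨_, (summable_of_sum_le hf hsum).hasSum, Real.tsum_le_of_sum_le hf hsum⟩

theorem injective_add_fst_of_sum_eq (n : Fin 3 → ℤ)
    (P : (Fin 3 → ℤ) × (Fin 3 → ℤ) × (Fin 3 → ℤ) → Prop) :
    Function.Injective fun p : {q // q.1 + q.2.1 + q.2.2 = n ∧ P q} =>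
      (p.1.1 + p.1.2.1, p.1.1) := by
  rintro ⟨⟨a, b, c⟩, hn, _⟩ ⟨⟨a', b', c'⟩, hn', _⟩ h
  simp only [Prod.mk.injEq] at h
  obtain ⟨hab, rfl⟩ := h
  obtain rfl := add_left_cancel hab
  have hc : c = c' := add_left_cancel (hn.trans hn'.symm)
  rw [Subtype.mk.injEq, hc]

theorem resonant_product_moment_bound (β K : ℝ) (hβ : 0 < β) (hK : 1 ≤ K) :
    ∃ C : ℝ, 0 < C ∧ ∀ n : Fin 3 → ℤ, ∃ L : ℝ,
      HasSum (fun p : {q : (Fin 3 → ℤ) × (Fin 3 → ℤ) × (Fin 3 → ℤ) //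
          q.1 + q.2.1 + q.2.2 = n ∧ q.1 + q.2.1 ≠ 0 ∧
          K⁻¹ * latNorm q.2.2 ≤ latNorm (q.1 + q.2.1) ∧
          latNorm (q.1 + q.2.1) ≤ K * latNorm q.2.2} =>
        jb (p.1.1 + p.1.2.1) ^ (-(2 * β)) * jb p.1.1 ^ (-(2 : ℝ)) *
          jb p.1.2.1 ^ (-(2 : ℝ)) * jb p.1.2.2 ^ (-(2 : ℝ))) L ∧
      L ≤ C * jb n ^ (-(2 * β)) := by
  obtain ⟨C₁, hC₁, hconv⟩ := exists_tsum_convolution_le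
  obtain ⟨C₂, hC₂, htail⟩ := exists_tsum_jb_rpow_le (s := 2 * β) (by positivity)
  let D : ℝ := K ^ 2 * (2 + K) ^ (1 + 2 * β)
  have hD : 0 < D := by positivity
  refine ⟨D * C₁ * C₂, by positivity, fun n => ?_⟩
  have hpos := jb_pos
  let w (m : Fin 3 → ℤ) : ℝ := D * (jb m ^ (-(1 : ℝ)) * (jb n + jb m) ^ (-(1 + 2 * β)))
  have hw (m) : 0 ≤ w m := by
    have := hpos m
    have := hpos n
    positivity
  let g (q : (Fin 3 → ℤ) × (Fin 3 → ℤ)) : ENNReal :=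
    ENNReal.ofReal (w q.1) *
      ENNReal.ofReal (jb q.2 ^ (-(2 : ℝ)) * jb (q.1 - q.2) ^ (-(2 : ℝ)))
  refine exists_hasSum_le_of_tsum_ofReal_le (fun p => ?_) ?_ ?_
  · have h1 := hpos (p.1.1 + p.1.2.1)
    have h2 := hpos p.1.1
    have h3 := hpos p.1.2.1
    have h4 := hpos p.1.2.2
    simp only [Pi.zero_apply]
    positivity
  · have := hpos n
    positivity
  calc _ ≤ ∑' p : {q : (Fin 3 → ℤ) × (Fin 3 → ℤ) × (Fin 3 → ℤ) //
          q.1 + q.2.1 + q.2.2 = n ∧ q.1 + q.2.1 ≠ 0 ∧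
          K⁻¹ * latNorm q.2.2 ≤ latNorm (q.1 + q.2.1) ∧
          latNorm (q.1 + q.2.1) ≤ K * latNorm q.2.2}, g (p.1.1 + p.1.2.1, p.1.1) := by
        refine ENNReal.tsum_le_tsum ?_
        rintro ⟨⟨a, b, c⟩, rfl, -, h1, h2⟩
        simp only [g]
        rw [← ENNReal.ofReal_mul (hw _), add_sub_cancel_left]
        refine ENNReal.ofReal_le_ofReal ?_
        have ha := hpos a
        have hb := hpos b
        calc _ = (jb (a + b) ^ (-(2 * β)) * jb c ^ (-(2 : ℝ))) *
              (jb a ^ (-(2 : ℝ)) * jb b ^ (-(2 : ℝ))) := by ring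
          _ ≤ _ := by
            gcongr
            exact resonant_term_le hβ hK h1 h2
    _ ≤ ∑' q, g q :=
        ENNReal.tsum_comp_le_tsum_of_injective (injective_add_fst_of_sum_eq n _) g
    _ = ∑' m, ENNReal.ofReal (w m) *
          ∑' a, ENNReal.ofReal (jb a ^ (-(2 : ℝ)) * jb (m - a) ^ (-(2 : ℝ))) := by
        rw [ENNReal.tsum_prod']
        simp only [g, ENNReal.tsum_mul_left]
    _ ≤ ∑' m, ENNReal.ofReal (w m) * ENNReal.ofReal (C₁ * jb m ^ (-(1 : ℝ))) := by
        gcongr with m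
        exact hconv m
    _ = ∑' m, ENNReal.ofReal (D * C₁) *
          ENNReal.ofReal (jb m ^ (-(2 : ℝ)) * (jb n + jb m) ^ (-(1 + 2 * β))) := by
        refine tsum_congr fun m => ?_
        rw [← ENNReal.ofReal_mul (hw m), ← ENNReal.ofReal_mul (by positivity)]
        congr 1
        have : jb m ^ (-(2 : ℝ)) = jb m ^ (-(1 : ℝ)) * jb m ^ (-(1 : ℝ)) := by
          rw [← Real.rpow_add (hpos m)]
          norm_num
        simp only [w, this]
        ring
    _ ≤ ENNReal.ofReal (D * C₁) * ENNReal.ofReal (C₂ * jb n ^ (-(2 * β))) := by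
        rw [ENNReal.tsum_mul_left]
        gcongr
        exact htail _ (hpos n)
    _ = _ := by
        rw [← ENNReal.ofReal_mul (by positivity), mul_assoc (D * C₁)]

end
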